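/- arXiv:2405.08486 — 3 statements merged into one kernel-verified Lean document; each statement's English description precedes it below -/
import Mathlib

section
/- Let f : ℝ^p → ℝ and x, x' ∈ ℝ^p, and suppose h(t) = f(t·x' + (1−t)·x) is differentiable on [0,1] with integrable derivative. Suppose there is a partition 0 = t_0 ≤ t_1 ≤ … ≤ t_{k−1} ≤ t_k = 1 such that h is monotone (non-decreasing or non-increasing) on each subinterval [t_{l−1}, t_l] for l = 1,…,k. Then the path distance satisfies d_path(x, x') = Σ_{l=1}^{k} |f(t_{l−1}·x' + (1−t_{l−1})·x) − f(t_l·x' + (1−t_l)·x)|. -/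
open MeasureTheory Set

theorem Fin.sum_univ_succ_sub_castSucc {M : Type*} [AddCommGroup M] {k : ℕ}
    (F : Fin (k + 1) → M) :
    ∑ l : Fin k, (F l.succ - F l.castSucc) = F (Fin.last k) - F 0 := by
  induction k with
  | zero => simp
  | succ k ih =>
    rw [Fin.sum_univ_castSucc]
    have := ih (fun i => F i.castSucc)
    simp only [Fin.castSucc_zero] at this
    simp only [Fin.succ_castSucc, Fin.succ_last, this]
    abel

theorem MonotoneOn.integral_abs_deriv_eq_sub {h : ℝ → ℝ} {a b : ℝ} (hab : a ≤ b)
    (hmono : MonotoneOn h (Icc a b)) (hdiff : ∀ t ∈ Icc a b, DifferentiableAt ℝ h t)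
    (hint : IntervalIntegrable (deriv h) volume a b) :
    ∫ t in a..b, |deriv h t| = h b - h a := by
  rcases hab.eq_or_lt with rfl | hlt
  · simp
  rw [← uIcc_of_le hab] at hdiff
  rw [← intervalIntegral.integral_deriv_eq_sub hdiff hint]
  refine intervalIntegral.integral_congr fun t ht => abs_of_nonneg ?_
  rw [← (hdiff t ht).derivWithin (uniqueDiffOn_Icc hlt t (by rwa [uIcc_of_le hab] at ht))]
  exact hmono.derivWithin_nonneg

theorem integral_abs_deriv_eq_abs_sub_of_monotoneOn_or_antitoneOn {h : ℝ → ℝ} {a b : ℝ}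
    (hab : a ≤ b) (hmono : MonotoneOn h (Icc a b) ∨ AntitoneOn h (Icc a b))
    (hdiff : ∀ t ∈ Icc a b, DifferentiableAt ℝ h t)
    (hint : IntervalIntegrable (deriv h) volume a b) :
    ∫ t in a..b, |deriv h t| = |h a - h b| := by
  have ha : a ∈ Icc a b := left_mem_Icc.2 hab
  have hb : b ∈ Icc a b := right_mem_Icc.2 hab
  rcases hmono with hmono | hanti
  · rw [hmono.integral_abs_deriv_eq_sub hab hdiff hint, abs_sub_comm,
      abs_of_nonneg (sub_nonneg.2 (hmono ha hb hab))]
  · have hd : deriv (fun t => -h t) = fun t => -deriv h t := funext fun t => deriv.fun_neg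
    have hneg := hanti.neg.integral_abs_deriv_eq_sub hab (fun t ht => (hdiff t ht).neg)
      (hd ▸ hint.neg)
    simp only [hd, abs_neg] at hneg
    rw [hneg, abs_of_nonneg (sub_nonneg.2 (hanti ha hb hab))]
    ring

/-- If `h(t) = f(t·x' + (1−t)·x)` is differentiable on `[0,1]` with integrable
derivative, and there is a partition `0 = t_0 ≤ t_1 ≤ … ≤ t_k = 1` such that `h`
is monotone on each subinterval, then the path distance
`d_path(x,x') = ∫_0^1 |h'(t)| dt` equals the sum of the absolute changes of `f`
over the subintervals. -/
theorem path_distance_eq_sum_of_piecewise_monotone {p : ℕ} (f : (Fin p → ℝ) → ℝ)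
    (x x' : Fin p → ℝ)
    (h : ℝ → ℝ) (hh : h = fun t : ℝ => f (t • x' + (1 - t) • x))
    (hdiff : ∀ t ∈ Icc (0 : ℝ) 1, DifferentiableAt ℝ h t)
    (hint : IntervalIntegrable (deriv h) volume 0 1)
    (k : ℕ) (τ : Fin (k + 1) → ℝ) (hτmono : Monotone τ)
    (hτ0 : τ 0 = 0) (hτk : τ (Fin.last k) = 1)
    (hmono : ∀ l : Fin k,
      MonotoneOn h (Icc (τ l.castSucc) (τ l.succ)) ∨
      AntitoneOn h (Icc (τ l.castSucc) (τ l.succ))) :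
    (∫ t in (0 : ℝ)..1, |deriv h t|) =
      ∑ l : Fin k,
        |f (τ l.castSucc • x' + (1 - τ l.castSucc) • x) -
          f (τ l.succ • x' + (1 - τ l.succ) • x)| := by
  have hτmem : ∀ i, τ i ∈ Icc (0 : ℝ) 1 := fun i =>
    ⟨hτ0 ▸ hτmono (Fin.zero_le i), hτk ▸ hτmono (Fin.le_last i)⟩
  have hint' : ∀ i j, IntervalIntegrable (deriv h) volume (τ i) (τ j) := fun i j =>
    hint.mono_set <| by
      rw [uIcc_of_le zero_le_one]
      exact uIcc_subset_Icc (hτmem i) (hτmem j)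
  have hterm : ∀ l : Fin k,
      |f (τ l.castSucc • x' + (1 - τ l.castSucc) • x) -
        f (τ l.succ • x' + (1 - τ l.succ) • x)| =
      (∫ t in τ 0..τ l.succ, |deriv h t|) - ∫ t in τ 0..τ l.castSucc, |deriv h t| := by
    intro l
    rw [intervalIntegral.integral_interval_sub_left (hint' _ _).abs (hint' _ _).abs,
      integral_abs_deriv_eq_abs_sub_of_monotoneOn_or_antitoneOn
        (hτmono (Fin.castSucc_lt_succ (i := l)).le) (hmono l)
        (fun t ht => hdiff t (Icc_subset_Icc (hτmem _).1 (hτmem _).2 ht)) (hint' _ _), hh]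
  rw [Finset.sum_congr rfl fun l _ => hterm l,
    Fin.sum_univ_succ_sub_castSucc fun i => ∫ t in τ 0..τ i, |deriv h t|]
  simp [hτ0, hτk]
end

section
/- Fix β > 0, and for j = 1,…,m let f_j : ℝ^p → ℝ be given by f_j(x) = a_j + b_j·g_β(⟨w_j, x⟩) with a_j ∈ ℝ, b_j ∈ {−1, +1}, w_j ∈ ℝ^p, where g_β(z) = log(1 + e^{βz})/β is the softplus function. Let f = Σ_{j=1}^m f_j. Then for all x, x' ∈ ℝ^p, the path distance is bounded above by the embedding distance: d_path(x, x') ≤ d_emb(x, x'), where d_emb(x, x') = Σ_{j=1}^m |f_j(x) − f_j(x')|. -/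
open MeasureTheory Set

/-- The derivative of a weak learner of softplus type along an affine line. -/
theorem hasDerivAt_softplus_line {β : ℝ} (hβ : 0 < β) (a b c d t : ℝ) :
    HasDerivAt (fun t : ℝ => a + b * (Real.log (1 + Real.exp (β * (c + t * d))) / β))
      (b * d * (Real.exp (β * (c + t * d)) / (1 + Real.exp (β * (c + t * d))))) t := by
  have hpos : 1 + Real.exp (β * (c + t * d)) ≠ 0 := by positivity
  have h := (((((((hasDerivAt_id t).mul_const d).const_add c).const_mul β).exp.const_add
    1).log hpos).div_const β).const_mul b |>.const_add a
  refine h.congr_deriv ?_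
  simp only [id]
  field_simp

/-- If `φ' = k * h` with `h` continuous and nonnegative, then `φ` is monotone or antitone, and its
total variation on `[0, 1]` is the absolute value of its increment. -/
theorem integral_abs_const_mul_eq_abs_sub {φ h : ℝ → ℝ} {k : ℝ} (hh : Continuous h)
    (h_nonneg : ∀ t, 0 ≤ h t) (hφ : ∀ t, HasDerivAt φ (k * h t) t) :
    ∫ t in (0 : ℝ)..1, |k * h t| = |φ 0 - φ 1| := by
  have hint : ∫ t in (0 : ℝ)..1, k * h t = φ 1 - φ 0 :=
    intervalIntegral.integral_eq_sub_of_hasDerivAt (fun t _ => hφ t)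
      ((continuous_const.mul hh).intervalIntegrable _ _)
  rw [abs_sub_comm, ← hint, intervalIntegral.integral_const_mul, abs_mul,
    abs_of_nonneg (intervalIntegral.integral_nonneg zero_le_one fun t _ => h_nonneg t),
    ← intervalIntegral.integral_const_mul]
  simp only [abs_mul, abs_of_nonneg (h_nonneg _)]

/-- For GBMAP weak learners `f_j(x) = a_j + b_j·g_β(⟨w_j, x⟩)` (with softplus
`g_β(z) = log(1 + e^{βz})/β`) and `f = Σ_j f_j`, the path distance is bounded
above by the embedding distance: `d_path(x,x') ≤ d_emb(x,x') = Σ_j |f_j(x) − f_j(x')|`. -/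
theorem path_distance_le_embedding_distance {p m : ℕ} (β : ℝ) (hβ : 0 < β)
    (a : Fin m → ℝ) (b : Fin m → ℝ) (hb : ∀ j, b j = -1 ∨ b j = 1)
    (w : Fin m → Fin p → ℝ)
    (fj : Fin m → (Fin p → ℝ) → ℝ)
    (hfj : ∀ j xx, fj j xx =
      a j + b j * (Real.log (1 + Real.exp (β * ∑ i, w j i * xx i)) / β))
    (f : (Fin p → ℝ) → ℝ) (hf : ∀ xx, f xx = ∑ j, fj j xx)
    (x x' : Fin p → ℝ) :
    (∫ t in (0 : ℝ)..1, |deriv (fun t : ℝ => f (t • x' + (1 - t) • x)) t|) ≤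
      ∑ j, |fj j x - fj j x'| := by
  set c : Fin m → ℝ := fun j => ∑ i, w j i * x i
  set d : Fin m → ℝ := fun j => ∑ i, w j i * (x' i - x i)
  set h : Fin m → ℝ → ℝ := fun j t =>
    Real.exp (β * (c j + t * d j)) / (1 + Real.exp (β * (c j + t * d j)))
  have h_cont (j) : Continuous (h j) :=
    Continuous.div (by fun_prop) (by fun_prop) fun t => by positivity
  have h_nonneg (j) (t) : 0 ≤ h j t := by positivity
  have hline (j) : (fun t : ℝ => fj j (t • x' + (1 - t) • x)) =
      fun t => a j + b j * (Real.log (1 + Real.exp (β * (c j + t * d j))) / β) := by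
    funext t
    have : ∑ i, w j i * (t • x' + (1 - t) • x) i = c j + t * d j := by
      simp only [c, d, Finset.mul_sum, ← Finset.sum_add_distrib]
      refine Finset.sum_congr rfl fun i _ => ?_
      simp only [Pi.add_apply, Pi.smul_apply, smul_eq_mul]
      ring
    rw [hfj, this]
  have hderiv (j) (t : ℝ) : HasDerivAt (fun t : ℝ => fj j (t • x' + (1 - t) • x))
      (b j * d j * h j t) t := by
    rw [hline]
    exact hasDerivAt_softplus_line hβ _ _ _ _ t
  have hf_deriv (t : ℝ) : deriv (fun t : ℝ => f (t • x' + (1 - t) • x)) t =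
      ∑ j, b j * d j * h j t := by
    simp only [hf]
    exact (HasDerivAt.fun_sum fun j _ => hderiv j t).deriv
  have h_int (j) : IntervalIntegrable (fun t => |b j * d j * h j t|) volume 0 1 :=
    (continuous_const.mul (h_cont j)).abs.intervalIntegrable _ _
  simp only [hf_deriv]
  calc ∫ t in (0 : ℝ)..1, |∑ j, b j * d j * h j t|
      ≤ ∫ t in (0 : ℝ)..1, ∑ j, |b j * d j * h j t| := by
        refine intervalIntegral.integral_mono zero_le_one ?_ ?_
          fun t => Finset.abs_sum_le_sum_abs _ _
        · exact (continuous_finsetSum _ fun j _ =>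
            continuous_const.mul (h_cont j)).abs.intervalIntegrable _ _
        · exact (continuous_finsetSum _ fun j _ =>
            (continuous_const.mul (h_cont j)).abs).intervalIntegrable _ _
    _ = ∑ j, ∫ t in (0 : ℝ)..1, |b j * d j * h j t| :=
        intervalIntegral.integral_finsetSum fun j _ => h_int j
    _ = ∑ j, |fj j x - fj j x'| := by
        refine Finset.sum_congr rfl fun j _ => ?_
        rw [integral_abs_const_mul_eq_abs_sub (h_cont j) (h_nonneg j) (hderiv j)]
        simp
end

section
/- Fix β > 0, and for j = 1,…,m let f_j : ℝ^p → ℝ be given by f_j(x) = a_j + b_j·g_β(⟨w_j, x⟩) with a_j ∈ ℝ, b_j ∈ {−1, +1}, w_j ∈ ℝ^p, where g_β(z) = log(1 + e^{βz})/β. Let f = Σ_{j=1}^m f_j. Then for all x, x' ∈ ℝ^p the chain of inequalities |f(x') − f(x)| ≤ d_path(x, x') ≤ d_emb(x, x') holds, where d_path(x, x') = ∫_0^1 |(∂/∂t) f(t·x' + (1−t)·x)| dt and d_emb(x, x') = Σ_{j=1}^m |f_j(x) − f_j(x')|. -/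
open MeasureTheory Set

theorem abs_sub_le_integral_abs_of_hasDerivAt {u u' : ℝ → ℝ}
    (hu : ∀ t, HasDerivAt u (u' t) t) (hc : Continuous u') :
    |u 1 - u 0| ≤ ∫ t in (0 : ℝ)..1, |u' t| := by
  rw [← intervalIntegral.integral_eq_sub_of_hasDerivAt (fun t _ => hu t)
    (hc.intervalIntegrable 0 1)]
  exact intervalIntegral.abs_integral_le_integral_abs zero_le_one

theorem integral_abs_eq_abs_sub_of_hasDerivAt {u k : ℝ → ℝ} {s : ℝ}
    (hu : ∀ t, HasDerivAt u (s * k t) t) (hc : Continuous k) (hk : ∀ t, 0 ≤ k t) :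
    ∫ t in (0 : ℝ)..1, |s * k t| = |u 1 - u 0| := by
  rw [← intervalIntegral.integral_eq_sub_of_hasDerivAt (fun t _ => hu t)
    ((continuous_const.mul hc).intervalIntegrable 0 1)]
  simp only [abs_mul, abs_of_nonneg (hk _), intervalIntegral.integral_const_mul]
  rw [abs_of_nonneg (intervalIntegral.integral_nonneg zero_le_one fun t _ => hk t)]

theorem hasDerivAt_affine_softplus {β : ℝ} (hβ : β ≠ 0) (a b c d t : ℝ) :
    HasDerivAt (fun t : ℝ => a + b * (Real.log (1 + Real.exp (β * (c + t * d))) / β))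
      (b * d * (Real.exp (β * (c + t * d)) / (1 + Real.exp (β * (c + t * d))))) t := by
  have hpos : 1 + Real.exp (β * (c + t * d)) ≠ 0 := by positivity
  have h := (((((((hasDerivAt_id t).mul_const d).const_add c).const_mul β).exp.const_add 1).log
    hpos).div_const β |>.const_mul b).const_add a
  refine h.congr_deriv ?_
  simp only [id]
  field_simp

/-- For GBMAP weak learners `f_j(x) = a_j + b_j·g_β(⟨w_j, x⟩)` and `f = Σ_j f_j`,
the chain of inequalities `|f(x') − f(x)| ≤ d_path(x,x') ≤ d_emb(x,x')` holds,
where `d_path(x,x') = ∫_0^1 |(∂/∂t) f(t·x' + (1−t)·x)| dt` and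
`d_emb(x,x') = Σ_j |f_j(x) − f_j(x')|`. -/
theorem abs_le_path_le_embedding {p m : ℕ} (β : ℝ) (hβ : 0 < β)
    (a : Fin m → ℝ) (b : Fin m → ℝ) (hb : ∀ j, b j = -1 ∨ b j = 1)
    (w : Fin m → Fin p → ℝ)
    (fj : Fin m → (Fin p → ℝ) → ℝ)
    (hfj : ∀ j xx, fj j xx =
      a j + b j * (Real.log (1 + Real.exp (β * ∑ i, w j i * xx i)) / β))
    (f : (Fin p → ℝ) → ℝ) (hf : ∀ xx, f xx = ∑ j, fj j xx)
    (x x' : Fin p → ℝ) :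
    |f x' - f x| ≤
        (∫ t in (0 : ℝ)..1, |deriv (fun t : ℝ => f (t • x' + (1 - t) • x)) t|) ∧
      (∫ t in (0 : ℝ)..1, |deriv (fun t : ℝ => f (t • x' + (1 - t) • x)) t|) ≤
        ∑ j, |fj j x - fj j x'| := by
  set c : Fin m → ℝ := fun j => ∑ i, w j i * x i
  set d : Fin m → ℝ := fun j => ∑ i, w j i * (x' i - x i)
  set k : Fin m → ℝ → ℝ := fun j t =>
    Real.exp (β * (c j + t * d j)) / (1 + Real.exp (β * (c j + t * d j)))
  have hk : ∀ j t, 0 ≤ k j t := fun j t => by positivity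
  have hkc : ∀ j, Continuous (k j) := fun j =>
    Continuous.div (by fun_prop) (by fun_prop) fun t => by positivity
  have hline : ∀ j (t : ℝ), ∑ i, w j i * (t • x' + (1 - t) • x) i = c j + t * d j := by
    intro j t
    simp only [c, d, Finset.mul_sum, ← Finset.sum_add_distrib]
    refine Finset.sum_congr rfl fun i _ => ?_
    simp only [Pi.add_apply, Pi.smul_apply, smul_eq_mul]
    ring
  have hder : ∀ j t, HasDerivAt (fun t : ℝ => fj j (t • x' + (1 - t) • x))
      (b j * d j * k j t) t := by
    intro j t
    simp only [hfj, hline]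
    exact hasDerivAt_affine_softplus hβ.ne' (a j) (b j) (c j) (d j) t
  have hderf : ∀ t, HasDerivAt (fun t : ℝ => f (t • x' + (1 - t) • x))
      (∑ j, b j * d j * k j t) t := by
    intro t
    simp only [hf]
    exact HasDerivAt.fun_sum fun j _ => hder j t
  have hterm : ∀ j, Continuous fun t => b j * d j * k j t := fun j =>
    continuous_const.mul (hkc j)
  have hcont : Continuous fun t => ∑ j, b j * d j * k j t :=
    continuous_finsetSum _ fun j _ => hterm j
  simp only [fun t => (hderf t).deriv]
  refine ⟨by simpa using abs_sub_le_integral_abs_of_hasDerivAt hderf hcont, ?_⟩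
  calc ∫ t in (0 : ℝ)..1, |∑ j, b j * d j * k j t|
      ≤ ∫ t in (0 : ℝ)..1, ∑ j, |b j * d j * k j t| :=
        intervalIntegral.integral_mono zero_le_one (hcont.abs.intervalIntegrable 0 1)
          ((continuous_finsetSum _ fun j _ => (hterm j).abs).intervalIntegrable 0 1)
          fun t => Finset.abs_sum_le_sum_abs _ _
    _ = ∑ j, ∫ t in (0 : ℝ)..1, |b j * d j * k j t| :=
        intervalIntegral.integral_finsetSum fun j _ => (hterm j).abs.intervalIntegrable 0 1
    _ = ∑ j, |fj j x - fj j x'| := by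
        refine Finset.sum_congr rfl fun j _ => ?_
        rw [integral_abs_eq_abs_sub_of_hasDerivAt (hder j) (hkc j) (hk j), abs_sub_comm]
        simp
end
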